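/- A uniformly random one-sided cellular automaton is non-regular with high probability: for every ε > 0 there exists n₀ such that for all n ≥ 2 and r ≥ 1 with n + r ≥ n₀, if A is an alphabet with |A| = n and a local rule φ : A^{r+1} → A is chosen uniformly at random among all n^(n^(r+1)) such rules, then the probability that the cellular automaton f_φ : A^ℤ → A^ℤ defined by f_φ(x)_i = φ(x_i, x_{i+1}, …, x_{i+r}) is von Neumann regular in End(A^ℤ) is at most ε. -/

import Mathlib

/-- The shift map on the full shift `A^ℤ`: `σ(x)_i = x_{i+1}`. -/
def shiftMap {A : Type*} (x : ℤ → A) : ℤ → A := fun i => x (i + 1)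

/-- A cellular automaton on the full shift `A^ℤ` (with the product topology,
`A` discrete): a continuous map commuting with the shift. -/
def IsCA {A : Type*} [TopologicalSpace A] (f : (ℤ → A) → (ℤ → A)) : Prop :=
  Continuous f ∧ ∀ x, f (shiftMap x) = shiftMap (f x)

/-- `f` is von Neumann regular in the monoid `End(A^ℤ)` of cellular automata:
there is a CA `h` with `f ∘ h ∘ f = f` and `h ∘ f ∘ h = h`. -/
def IsRegularCA {A : Type*} [TopologicalSpace A] (f : (ℤ → A) → (ℤ → A)) : Prop :=
  ∃ h : (ℤ → A) → (ℤ → A), IsCA h ∧ f ∘ h ∘ f = f ∧ h ∘ f ∘ h = h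

/-- The one-sided cellular automaton of radius `r` with local rule
`φ : A^{r+1} → A`: `f_φ(x)_i = φ(x_i, x_{i+1}, …, x_{i+r})`. -/
def caOfRule {A : Type*} {r : ℕ} (φ : (Fin (r + 1) → A) → A)
    (x : ℤ → A) : ℤ → A :=
  fun i => φ (fun k => x (i + (k.val : ℤ)))

open Finset in
/-- Second moment bound: if the events `E y` are pairwise negatively correlated and each has
density at least `c`, then few points avoid all of them. -/
theorem card_avoid_le {Ω Y : Type*} [Fintype Ω] [Fintype Y] [DecidableEq Ω]
    (E : Y → Finset Ω) (c : ℝ) (hc : 0 < c)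
    (hE : ∀ y, c * Fintype.card Ω ≤ (#(E y) : ℝ))
    (hneg : ∀ y y', y ≠ y' →
      (Fintype.card Ω : ℝ) * #(E y ∩ E y') ≤ #(E y) * #(E y')) :
    (#{ω | ∀ y, ω ∉ E y} : ℝ) * (Fintype.card Y * c) ≤ Fintype.card Ω := by
  classical
  rcases isEmpty_or_nonempty Ω with hΩ | hΩ
  · simp [Finset.univ_eq_empty]
  rcases isEmpty_or_nonempty Y with hY | hY
  · simp
  have hN : (0 : ℝ) < Fintype.card Ω := by exact_mod_cast Fintype.card_pos
  have hYc : (0 : ℝ) < Fintype.card Y := by exact_mod_cast Fintype.card_pos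
  set N : ℝ := (Fintype.card Ω : ℝ) with hNdef
  set X : Ω → ℝ := fun ω => ∑ y, if ω ∈ E y then 1 else 0 with hX
  set S : ℝ := ∑ y, (#(E y) : ℝ) with hS
  have hsum : ∑ ω, X ω = S := by
    simp only [hX, hS]
    rw [Finset.sum_comm]
    simp
  have hsq : ∑ ω, X ω ^ 2 = ∑ y, ∑ y', (#(E y ∩ E y') : ℝ) := by
    simp only [hX, sq, Finset.sum_mul_sum]
    rw [Finset.sum_comm]
    refine Finset.sum_congr rfl fun y _ => ?_
    rw [Finset.sum_comm]
    refine Finset.sum_congr rfl fun y' _ => ?_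
    simp only [mul_ite, mul_one, mul_zero, ← ite_and]
    rw [Finset.sum_boole]
    congr 2
    ext ω
    simp [and_comm]
  have hsq_le : N * ∑ ω, X ω ^ 2 ≤ N * S + S ^ 2 := by
    rw [hsq, hS, sq, Finset.sum_mul_sum, Finset.mul_sum, Finset.mul_sum, ← Finset.sum_add_distrib]
    refine Finset.sum_le_sum fun y _ => ?_
    rw [Finset.mul_sum, ← Finset.add_sum_erase _ _ (mem_univ y), Finset.inter_self]
    gcongr
    calc _ ≤ ∑ y' ∈ univ.erase y, (#(E y) : ℝ) * #(E y') :=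
          Finset.sum_le_sum fun y' hy' => hneg y y' (Finset.ne_of_mem_erase hy').symm
      _ ≤ _ := Finset.sum_le_sum_of_subset_of_nonneg (Finset.subset_univ _)
          fun _ _ _ => by positivity
  set Z : ℝ := (#{ω | ∀ y, ω ∉ E y} : ℝ) with hZ
  have hvar : Z * S ^ 2 ≤ ∑ ω, (N * X ω - S) ^ 2 := by
    calc Z * S ^ 2 = ∑ ω with ∀ y, ω ∉ E y, (N * X ω - S) ^ 2 := by
          rw [hZ, ← nsmul_eq_mul, ← Finset.sum_const]
          refine Finset.sum_congr rfl fun ω hω => ?_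
          have : X ω = 0 := by
            simp only [mem_filter_univ] at hω
            simp [hX, hω]
          rw [this]; ring
      _ ≤ _ := Finset.sum_le_sum_of_subset_of_nonneg (Finset.subset_univ _)
          fun _ _ _ => by positivity
  have hexp : ∑ ω, (N * X ω - S) ^ 2 = N * (N * ∑ ω, X ω ^ 2) - N * S ^ 2 := by
    have : ∀ ω, (N * X ω - S) ^ 2 = N ^ 2 * X ω ^ 2 - 2 * N * S * X ω + S ^ 2 := fun ω => by ring
    simp only [this, Finset.sum_add_distrib, Finset.sum_sub_distrib, ← Finset.mul_sum, hsum,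
      Finset.sum_const, nsmul_eq_mul, Finset.card_univ]
    rw [← hNdef]; ring
  have hSlow : Fintype.card Y * c * N ≤ S := by
    calc _ = ∑ _y : Y, c * N := by simp [mul_assoc]
      _ ≤ S := Finset.sum_le_sum fun y _ => hE y
  have hSpos : 0 < S := lt_of_lt_of_le (by positivity) hSlow
  have h1 : Z * S ^ 2 ≤ N ^ 2 * S := by
    nlinarith [mul_le_mul_of_nonneg_left hsq_le hN.le]
  have h2 : Z * S ≤ N ^ 2 := by
    refine le_of_mul_le_mul_right ?_ hSpos
    linarith
  have hZ0 : 0 ≤ Z := by positivity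
  refine le_of_mul_le_mul_right ?_ hN
  nlinarith [mul_le_mul_of_nonneg_left hSlow hZ0]

open Finset in
/-- Restriction along an injection pushes the uniform measure on functions to the uniform
measure. -/
theorem card_filter_comp_injective {I W A : Type*} [Fintype I] [Fintype W] [Fintype A]
    [DecidableEq I] [DecidableEq W] (e : I → W) (he : Function.Injective e)
    (S : (I → A) → Prop) [DecidablePred S] :
    #{φ : W → A | S (φ ∘ e)} * Fintype.card (I → A) = #{ψ | S ψ} * Fintype.card (W → A) := by
  classical
  let T := {w // ¬ w ∈ Set.range e}
  let F : (W → A) ≃ (I → A) × (T → A) :=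
    (Equiv.piEquivPiSubtypeProd (· ∈ Set.range e) (fun _ => A)).trans
      (Equiv.prodCongr (Equiv.arrowCongr (Equiv.ofInjective e he).symm (Equiv.refl A))
        (Equiv.refl _))
  have hF : ∀ φ, (F φ).1 = φ ∘ e := fun φ => rfl
  have h1 : #{φ : W → A | S (φ ∘ e)} = #{ψ | S ψ} * Fintype.card (T → A) := by
    rw [← Finset.card_univ (α := T → A), ← Finset.card_product]
    refine Finset.card_equiv F fun φ => ?_
    simp [← hF]
  rw [h1, Fintype.card_congr F, Fintype.card_prod]
  ring

section
variable {U V R Q : Type*} [Fintype U] [Fintype R] [Fintype V] [Fintype Q] [DecidableEq U]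
    [DecidableEq V] [DecidableEq R] [DecidableEq Q]
open Finset

theorem cast_card_compl_eq_sub (s : Finset U) : ((#sᶜ : ℕ) : ℝ) = (Fintype.card U : ℝ) - #s := by
  rw [card_compl, Nat.cast_sub (card_le_univ _)]

theorem card_piFinset_compl (s : Finset U) :
    (#(Fintype.piFinset fun _ : R => sᶜ) : ℝ) =
      ((Fintype.card U : ℝ) - #s) ^ Fintype.card R := by
  rw [Fintype.card_piFinset, prod_const, Nat.cast_pow, cast_card_compl_eq_sub, card_univ]

theorem piFinset_compl_inter (s t : Finset U) :
    (Fintype.piFinset fun _ : R => sᶜ) ∩ (Fintype.piFinset fun _ : R => tᶜ) =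
      Fintype.piFinset fun _ : R => (s ∪ t)ᶜ := by
  ext x
  simp [← forall_and]

/-- The pairs of functions whose first component avoids `B` and whose second component
meets `D`. -/
def avoidMeet (B : Finset U) (D : Finset V) : Finset ((R → U) × (Q → V)) :=
  (Fintype.piFinset fun _ => Bᶜ) ×ˢ (Fintype.piFinset fun _ => Dᶜ)ᶜ

theorem mem_avoidMeet {B : Finset U} {D : Finset V} {w : (R → U) × (Q → V)} :
    w ∈ avoidMeet B D ↔ (∀ o, w.1 o ∉ B) ∧ ∃ q, w.2 q ∈ D := by
  simp [avoidMeet]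

theorem card_avoidMeet (B : Finset U) (D : Finset V) :
    (#(avoidMeet B D : Finset ((R → U) × (Q → V))) : ℝ) =
      ((Fintype.card U : ℝ) - #B) ^ Fintype.card R *
        ((Fintype.card V : ℝ) ^ Fintype.card Q -
          ((Fintype.card V : ℝ) - #D) ^ Fintype.card Q) := by
  rw [avoidMeet, card_product, Nat.cast_mul, card_piFinset_compl, cast_card_compl_eq_sub,
    card_piFinset_compl, Fintype.card_fun, Nat.cast_pow]

theorem card_avoidMeet_inter {B B' : Finset U} {D D' : Finset V} (hB : Disjoint B B')
    (hD : Disjoint D D') :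
    (#(avoidMeet B D ∩ avoidMeet B' D' : Finset ((R → U) × (Q → V))) : ℝ) =
      ((Fintype.card U : ℝ) - #B - #B') ^ Fintype.card R *
        ((Fintype.card V : ℝ) ^ Fintype.card Q -
          ((Fintype.card V : ℝ) - #D) ^ Fintype.card Q -
          ((Fintype.card V : ℝ) - #D') ^ Fintype.card Q +
          ((Fintype.card V : ℝ) - #D - #D') ^ Fintype.card Q) := by
  have hunion := card_union_add_card_inter (Fintype.piFinset fun _ : Q => Dᶜ)
    (Fintype.piFinset fun _ : Q => D'ᶜ)
  rw [piFinset_compl_inter, ← @Nat.cast_inj ℝ, Nat.cast_add, Nat.cast_add, card_piFinset_compl,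
    card_piFinset_compl, card_piFinset_compl, card_union_of_disjoint hD] at hunion
  rw [avoidMeet, avoidMeet, product_inter_product, card_product, Nat.cast_mul,
    piFinset_compl_inter, card_piFinset_compl, ← compl_union, cast_card_compl_eq_sub,
    eq_sub_of_add_eq hunion, card_union_of_disjoint hB, Fintype.card_fun]
  push_cast
  ring

theorem card_avoidMeet_inter_le {B B' : Finset U} {D D' : Finset V} (hB : Disjoint B B')
    (hD : Disjoint D D') :
    (Fintype.card ((R → U) × (Q → V)) : ℝ) *
        #(avoidMeet B D ∩ avoidMeet B' D' : Finset ((R → U) × (Q → V))) ≤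
      #(avoidMeet B D : Finset ((R → U) × (Q → V))) *
        #(avoidMeet B' D' : Finset ((R → U) × (Q → V))) := by
  rw [card_avoidMeet_inter hB hD, card_avoidMeet, card_avoidMeet, Fintype.card_prod,
    Fintype.card_fun, Fintype.card_fun]
  push_cast
  have hU : (#B + #B' : ℝ) ≤ Fintype.card U := by
    rw [← Nat.cast_add, ← card_union_of_disjoint hB]
    exact_mod_cast card_le_univ _
  have hV : (#D + #D' : ℝ) ≤ Fintype.card V := by
    rw [← Nat.cast_add, ← card_union_of_disjoint hD]
    exact_mod_cast card_le_univ _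
  have key : ∀ (N a b : ℝ) (k : ℕ), 0 ≤ a → 0 ≤ b → a + b ≤ N →
      N ^ k * (N - a - b) ^ k ≤ (N - a) ^ k * (N - b) ^ k := by
    intro N a b k ha hb hab
    rw [← mul_pow, ← mul_pow]
    refine pow_le_pow_left₀ (mul_nonneg (by linarith) (by linarith)) ?_ k
    nlinarith
  have h1 := key (Fintype.card U) #B #B' (Fintype.card R) (by positivity) (by positivity) hU
  have h2 := key (Fintype.card V) #D #D' (Fintype.card Q) (by positivity) (by positivity) hV
  have hx : ∀ D : Finset V, (0 : ℝ) ≤ (Fintype.card V : ℝ) ^ Fintype.card Q -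
      ((Fintype.card V : ℝ) - #D) ^ Fintype.card Q := fun D => by
    have : (#D : ℝ) ≤ Fintype.card V := by exact_mod_cast card_le_univ _
    rw [sub_nonneg]
    exact pow_le_pow_left₀ (by linarith) (by linarith [(#D).cast_nonneg (α := ℝ)]) _
  have h0 : (0 : ℝ) ≤ ((Fintype.card U : ℝ) - #B) ^ Fintype.card R *
      ((Fintype.card U : ℝ) - #B') ^ Fintype.card R := by
    rw [← mul_pow]
    refine pow_nonneg (mul_nonneg ?_ ?_) _ <;>
      linarith [(#B).cast_nonneg (α := ℝ), (#B').cast_nonneg (α := ℝ)]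
  have hx1 := hx D
  have hx2 := hx D'
  set V0 := (Fintype.card V : ℝ) ^ Fintype.card Q
  set V1 := ((Fintype.card V : ℝ) - #D) ^ Fintype.card Q
  set V2 := ((Fintype.card V : ℝ) - #D') ^ Fintype.card Q
  set V3 := ((Fintype.card V : ℝ) - #D - #D') ^ Fintype.card Q
  set U0 := (Fintype.card U : ℝ) ^ Fintype.card R
  set U1 := ((Fintype.card U : ℝ) - #B) ^ Fintype.card R
  set U2 := ((Fintype.card U : ℝ) - #B') ^ Fintype.card R
  set U3 := ((Fintype.card U : ℝ) - #B - #B') ^ Fintype.card R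
  have h3 : V0 * (V0 - V1 - V2 + V3) ≤ (V0 - V1) * (V0 - V2) := by linarith
  calc U0 * V0 * (U3 * (V0 - V1 - V2 + V3)) = (U0 * U3) * (V0 * (V0 - V1 - V2 + V3)) := by ring
    _ ≤ (U1 * U2) * (V0 * (V0 - V1 - V2 + V3)) := by
      refine mul_le_mul_of_nonneg_right h1 ?_
      have := card_avoidMeet_inter (R := PEmpty.{1}) (Q := Q) (disjoint_empty_left (∅ : Finset U)) hD
      simp only [Fintype.card_pempty, pow_zero, one_mul] at this
      refine mul_nonneg (by positivity) ?_
      rw [← this]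
      positivity
    _ ≤ (U1 * U2) * ((V0 - V1) * (V0 - V2)) := mul_le_mul_of_nonneg_left h3 h0
    _ = _ := by ring

/-- If `b |R| ≤ |U|` and `|Q|` is comparable to `|V| / b`, then `avoidMeet` has density bounded
below by an absolute constant. -/
theorem le_card_avoidMeet (B : Finset U) (D : Finset V) (hBU : 2 * #B ≤ Fintype.card U)
    (hBR : Fintype.card R * #B ≤ Fintype.card U) (hV : 0 < Fintype.card V)
    (hDQ : Fintype.card V ≤ 4 * (Fintype.card Q * #D)) (hU : 0 < Fintype.card U) :
    Real.exp (-2) * (1 - Real.exp (-(1 / 4))) * Fintype.card ((R → U) × (Q → V)) ≤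
      (#(avoidMeet B D : Finset ((R → U) × (Q → V))) : ℝ) := by
  rw [card_avoidMeet, Fintype.card_prod, Fintype.card_fun, Fintype.card_fun]
  have hDV : (#D : ℝ) ≤ Fintype.card V := by exact_mod_cast card_le_univ D
  push_cast
  have hu0 : (0 : ℝ) < Fintype.card U := by exact_mod_cast hU
  have hv0 : (0 : ℝ) < Fintype.card V := by exact_mod_cast hV
  have hb0 : (0 : ℝ) ≤ #B := by positivity
  have hBU' : (2 * #B : ℝ) ≤ Fintype.card U := by exact_mod_cast hBU
  have hBR' : (Fintype.card R * #B : ℝ) ≤ Fintype.card U := by exact_mod_cast hBR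
  have hDQ' : (Fintype.card V : ℝ) ≤ 4 * (Fintype.card Q * #D) := by exact_mod_cast hDQ
  set u : ℝ := (Fintype.card U : ℝ)
  set v : ℝ := (Fintype.card V : ℝ)
  set k := Fintype.card R
  set l := Fintype.card Q
  set b : ℝ := (#B : ℝ)
  set d : ℝ := (#D : ℝ)
  have h1 : Real.exp (-2) * u ^ k ≤ (u - b) ^ k := by
    have ht : Real.exp (-(2 * (b / u))) ≤ 1 - b / u := by
      have h2 : b / u ≤ 1 / 2 := by rw [div_le_iff₀ hu0]; linarith
      have h3 : 0 ≤ b / u := by positivity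
      rw [Real.exp_neg, inv_le_comm₀ (Real.exp_pos _) (by linarith)]
      refine le_trans ?_ (Real.add_one_le_exp _)
      rw [inv_le_iff_one_le_mul₀ (by linarith)]
      nlinarith
    calc Real.exp (-2) * u ^ k ≤ Real.exp (-(2 * (b / u))) ^ k * u ^ k := by
          gcongr
          rw [← Real.exp_nat_mul]
          apply Real.exp_le_exp.2
          have : k * (b / u) ≤ 1 := by rw [← mul_div_assoc, div_le_one hu0]; exact hBR'
          linarith
      _ ≤ (1 - b / u) ^ k * u ^ k := by gcongr
      _ = (u - b) ^ k := by rw [← mul_pow]; congr 1; field_simp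
  have h2 : (v - d) ^ l ≤ Real.exp (-(1 / 4)) * v ^ l := by
    calc (v - d) ^ l = (1 - d / v) ^ l * v ^ l := by rw [← mul_pow]; congr 1; field_simp
      _ ≤ Real.exp (-(d / v)) ^ l * v ^ l := by
        have : 0 ≤ 1 - d / v := by rw [sub_nonneg, div_le_one hv0]; exact hDV
        gcongr
        exact Real.one_sub_le_exp_neg _
      _ ≤ _ := by
        gcongr
        rw [← Real.exp_nat_mul]
        apply Real.exp_le_exp.2
        have : 1 / 4 ≤ l * (d / v) := by rw [← mul_div_assoc, le_div_iff₀ hv0]; linarith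
        linarith
  have h3 : 0 ≤ 1 - Real.exp (-(1 / 4)) := by
    rw [sub_nonneg, Real.exp_le_one_iff]; norm_num
  calc _ = (Real.exp (-2) * u ^ k) * ((1 - Real.exp (-(1 / 4))) * v ^ l) := by ring
    _ ≤ (u - b) ^ k * (v ^ l - (v - d) ^ l) := by
      gcongr
      · exact pow_nonneg (by linarith) _
      · linarith

/-- Second moment bound for `avoidMeet`: for pairwise disjoint families of targets, almost all
pairs of functions lie in some `avoidMeet (B y) (D y)`. -/
theorem card_avoid_avoidMeet_le {Y : Type*} [Fintype Y] {b : ℕ} (B : Y → Finset U)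
    (D : Y → Finset V) (hB : ∀ y, #(B y) = b) (hD : ∀ y, #(D y) = b)
    (hBd : Pairwise (Function.onFun Disjoint B)) (hDd : Pairwise (Function.onFun Disjoint D))
    (hbU : 2 * b ≤ Fintype.card U) (hbR : Fintype.card R * b ≤ Fintype.card U)
    (hbQ : Fintype.card V ≤ 4 * (Fintype.card Q * b)) (hU : 0 < Fintype.card U)
    (hV : 0 < Fintype.card V) :
    (#{w : (R → U) × (Q → V) | ∀ y, w ∉ avoidMeet (B y) (D y)} : ℝ) *
        (Fintype.card Y * (Real.exp (-2) * (1 - Real.exp (-(1 / 4))))) ≤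
      Fintype.card ((R → U) × (Q → V)) := by
  refine card_avoid_le _ _ ?_ (fun y => ?_) fun y y' h =>
    card_avoidMeet_inter_le (hBd h) (hDd h)
  · refine mul_pos (Real.exp_pos _) ?_
    rw [sub_pos, Real.exp_lt_one_iff]; norm_num
  · exact le_card_avoidMeet _ _ (by rwa [hB]) (by rwa [hB]) hV (by rwa [hD]) hU

end

open Function in
/-- A transversal of the `f`-orbits of points of minimal period `q`. -/
theorem exists_orbit_transversal {α : Type} (f : α → α) {q : ℕ} (hq : 0 < q)
    (hfin : {x | minimalPeriod f x = q}.Finite) :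
    ∃ (R : Type) (_ : Fintype R) (ρ : R → α), (∀ o, minimalPeriod f (ρ o) = q) ∧
      (∀ x, minimalPeriod f x = q → ∃ o n, f^[n] (ρ o) = x) ∧
      (∀ o o' m n, f^[m] (ρ o) = f^[n] (ρ o') → o = o') ∧
      Fintype.card R * q = {x | minimalPeriod f x = q}.ncard := by
  classical
  let R := {c : Cycle α // ∃ x, minimalPeriod f x = q ∧ periodicOrbit f x = c}
  choose ρ hρ hρ' using fun c : R => c.2
  have hper : ∀ {x}, minimalPeriod f x = q → x ∈ periodicPts f := fun h =>
    minimalPeriod_pos_iff_mem_periodicPts.1 (h ▸ hq)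
  have hcov : ∀ x, minimalPeriod f x = q → ∃ o n, f^[n] (ρ o) = x := fun x hx =>
    ⟨⟨_, x, hx, rfl⟩, (mem_periodicOrbit_iff (hper (hρ _))).1
      ((hρ' ⟨_, x, hx, rfl⟩).symm ▸ self_mem_periodicOrbit (hper hx))⟩
  have hinj : ∀ o o' m n, f^[m] (ρ o) = f^[n] (ρ o') → o = o' := fun o o' m n h => by
    apply Subtype.ext
    rw [← hρ' o, ← hρ' o', ← periodicOrbit_apply_iterate_eq (hper (hρ o)) m, h,
      periodicOrbit_apply_iterate_eq (hper (hρ o')) n]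
  let F : R × Fin q → {x | minimalPeriod f x = q} := fun a =>
    ⟨f^[a.2] (ρ a.1), (minimalPeriod_apply_iterate (hper (hρ _)) _).trans (hρ _)⟩
  have hF : Bijective F := by
    constructor
    · rintro ⟨o, i⟩ ⟨o', j⟩ h
      have h' : f^[i] (ρ o) = f^[j] (ρ o') := congrArg Subtype.val h
      obtain rfl := hinj _ _ _ _ h'
      have := (iterate_eq_iterate_iff_of_lt_minimalPeriod ((hρ o).symm ▸ i.2)
        ((hρ o).symm ▸ j.2)).1 h'
      rw [Fin.ext this]
    · rintro ⟨x, hx⟩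
      obtain ⟨o, n, rfl⟩ := hcov x hx
      refine ⟨(o, ⟨n % q, Nat.mod_lt _ hq⟩), Subtype.ext ?_⟩
      have := iterate_mod_minimalPeriod_eq (f := f) (x := ρ o) (n := n)
      rwa [hρ o] at this
  have : Finite (R × Fin q) := by
    have := hfin.to_subtype
    exact Finite.of_injective F hF.1
  have : Finite R := Finite.of_injective (fun o : R => (o, (⟨0, hq⟩ : Fin q)))
    fun _ _ h => (Prod.ext_iff.1 h).1
  have := Fintype.ofFinite R
  refine ⟨R, this, ρ, hρ, hcov, hinj, ?_⟩
  rw [← Nat.card_coe_set_eq, ← Nat.card_eq_of_bijective F hF, Nat.card_prod, Nat.card_fin,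
    Nat.card_eq_fintype_card]

section
open Function

/-- The word of length `m` read off a configuration from position `0`. -/
def prefixWord {A : Type*} (m : ℕ) (x : ℤ → A) : Fin m → A := fun k => x k

theorem shiftMap_iterate_apply {A : Type*} (n : ℕ) (x : ℤ → A) (i : ℤ) :
    shiftMap^[n] x i = x (i + n) := by
  induction n generalizing x with
  | zero => simp
  | succ n ih => rw [iterate_succ_apply, ih, shiftMap]; push_cast; congr 1; ring

theorem apply_emod_of_isPeriodicPt {A : Type*} {q : ℕ} {x : ℤ → A}
    (hx : IsPeriodicPt shiftMap q x) (i : ℤ) : x (i % q) = x i := by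
  have h : Periodic x (q : ℤ) := fun i => by
    rw [← shiftMap_iterate_apply q x i, hx.eq]
  conv_rhs => rw [← Int.emod_add_mul_ediv i q, mul_comm]
  exact (h.int_mul (i / q) (i % q)).symm

theorem prefixWord_injOn {A : Type*} {q m : ℕ} (hq : 0 < q) (hqm : q ≤ m) :
    Set.InjOn (prefixWord (A := A) m) {x | IsPeriodicPt shiftMap q x} := by
  intro x hx y hy h
  funext i
  rw [← apply_emod_of_isPeriodicPt hx, ← apply_emod_of_isPeriodicPt hy]
  have h0 : 0 ≤ i % q := Int.emod_nonneg _ (by omega)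
  have h1 : i % q < q := Int.emod_lt_of_pos _ (by omega)
  have := congrFun h ⟨(i % q).toNat, by omega⟩
  simpa [prefixWord, h0] using this

theorem ncard_isPeriodicPt_shiftMap (A : Type*) [Fintype A] {q : ℕ} (hq : 0 < q) :
    {x : ℤ → A | IsPeriodicPt shiftMap q x}.ncard = Fintype.card A ^ q ∧
      {x : ℤ → A | IsPeriodicPt shiftMap q x}.Finite := by
  have hb : Set.BijOn (prefixWord (A := A) q) {x | IsPeriodicPt shiftMap q x} Set.univ := by
    refine ⟨Set.mapsTo_univ _ _, prefixWord_injOn hq le_rfl, fun w _ => ?_⟩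
    refine ⟨fun i => w ⟨(i % q).toNat, ?_⟩, ?_, ?_⟩
    · have := Int.emod_lt_of_pos i (b := q) (by omega)
      omega
    · funext i
      simp [shiftMap_iterate_apply]
    · funext k
      have : ((k : ℤ) % q).toNat = k := by
        rw [Int.emod_eq_of_lt (by omega) (by omega), Int.toNat_natCast]
      simp [prefixWord, this]
  refine ⟨?_, hb.finite_iff_finite.2 Set.finite_univ⟩
  have := hb.injOn.ncard_image
  rw [hb.image_eq] at this
  rw [← this, Set.ncard_univ, Nat.card_eq_fintype_card, Fintype.card_fun, Fintype.card_fin]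

theorem minimalPeriod_two_pow_succ_iff {α : Type*} {f : α → α} {k : ℕ} {x : α} :
    minimalPeriod f x = 2 ^ (k + 1) ↔
      IsPeriodicPt f (2 ^ (k + 1)) x ∧ ¬IsPeriodicPt f (2 ^ k) x := by
  refine ⟨fun h => ⟨h ▸ isPeriodicPt_minimalPeriod f x, fun h' => ?_⟩, fun h => ?_⟩
  · have := Nat.le_of_dvd (by positivity) h'.minimalPeriod_dvd
    rw [h, pow_succ] at this
    have : 0 < 2 ^ k := by positivity
    omega
  · exact minimalPeriod_eq_prime_pow h.2 h.1

theorem finite_minimalPeriod_shiftMap (A : Type*) [Fintype A] {q : ℕ} (hq : 0 < q) :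
    {x : ℤ → A | minimalPeriod shiftMap x = q}.Finite :=
  (ncard_isPeriodicPt_shiftMap A hq).2.subset fun x hx => by
    rw [Set.mem_ofPred_eq] at hx ⊢
    exact hx ▸ isPeriodicPt_minimalPeriod shiftMap x

theorem ncard_minimalPeriod_shiftMap_succ (A : Type*) [Fintype A] (k : ℕ) :
    {x : ℤ → A | minimalPeriod shiftMap x = 2 ^ (k + 1)}.ncard =
      Fintype.card A ^ 2 ^ (k + 1) - Fintype.card A ^ 2 ^ k := by
  have : {x : ℤ → A | minimalPeriod shiftMap x = 2 ^ (k + 1)} =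
      {x | IsPeriodicPt shiftMap (2 ^ (k + 1)) x} \ {x | IsPeriodicPt shiftMap (2 ^ k) x} := by
    ext x
    exact minimalPeriod_two_pow_succ_iff
  rw [this, Set.ncard_sdiff _ (ncard_isPeriodicPt_shiftMap A (by positivity)).2,
    (ncard_isPeriodicPt_shiftMap A (by positivity)).1,
    (ncard_isPeriodicPt_shiftMap A (by positivity)).1]
  intro x (hx : IsPeriodicPt _ _ x)
  exact hx.trans_dvd (pow_dvd_pow 2 (Nat.le_succ k))

theorem ncard_minimalPeriod_shiftMap_bounds (A : Type*) [Fintype A] (hA : 2 ≤ Fintype.card A)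
    (k : ℕ) :
    {x : ℤ → A | minimalPeriod shiftMap x = 2 ^ k}.ncard ≤ Fintype.card A ^ 2 ^ k ∧
      Fintype.card A ^ 2 ^ k ≤ 2 * {x : ℤ → A | minimalPeriod shiftMap x = 2 ^ k}.ncard := by
  cases k with
  | zero =>
    have : {x : ℤ → A | minimalPeriod shiftMap x = 2 ^ 0} =
        {x | IsPeriodicPt shiftMap (2 ^ 0) x} := by
      ext x
      simp [minimalPeriod_eq_one_iff_isFixedPt, IsPeriodicPt]
    rw [this, (ncard_isPeriodicPt_shiftMap A (by positivity)).1]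
    omega
  | succ k =>
    rw [ncard_minimalPeriod_shiftMap_succ]
    have h : 2 * Fintype.card A ^ 2 ^ k ≤ Fintype.card A ^ 2 ^ (k + 1) := by
      rw [pow_succ 2 k, pow_mul, sq]
      gcongr
      exact hA.trans (Nat.le_self_pow (by positivity) _)
    omega

end

section
open Function

theorem caOfRule_semiconj {A : Type*} {r : ℕ} (φ : (Fin (r + 1) → A) → A) :
    Semiconj (caOfRule φ) shiftMap shiftMap := fun x => by
  funext i
  simp only [caOfRule, shiftMap]
  congr 1; funext k; congr 1; ring

theorem caOfRule_apply_natCast {A : Type*} {r : ℕ} (φ : (Fin (r + 1) → A) → A) (x : ℤ → A)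
    (i : ℕ) : caOfRule φ x i = φ (prefixWord (r + 1) (shiftMap^[i] x)) := by
  simp only [caOfRule]
  congr 1; funext k
  rw [prefixWord, shiftMap_iterate_apply, add_comm]

/-- A regular cellular automaton satisfies the strong periodic point condition. -/
theorem IsRegularCA.exists_minimalPeriod_preimage {A : Type*} [TopologicalSpace A]
    {f : (ℤ → A) → (ℤ → A)} (hf : IsRegularCA f) (hs : Semiconj f shiftMap shiftMap)
    (x : ℤ → A) :
    ∃ z, minimalPeriod shiftMap z = minimalPeriod shiftMap (f x) ∧ f z = f x := by
  obtain ⟨h, hh, hfhf, -⟩ := hf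
  have hz : f (h (f x)) = f x := congrFun hfhf x
  refine ⟨h (f x), Nat.dvd_antisymm ?_ ?_, hz⟩
  · exact ((isPeriodicPt_minimalPeriod shiftMap (f x)).map hh.2).minimalPeriod_dvd
  · conv_lhs => rw [← hz]
    exact ((isPeriodicPt_minimalPeriod shiftMap _).map hs).minimalPeriod_dvd
end

section
open Function Finset

/-- The length `m` prefixes of the first `q` shifts of `x`. -/
def shiftPrefixes {A : Type*} [DecidableEq A] (m q : ℕ) (x : ℤ → A) : Finset (Fin m → A) :=
  univ.image fun j : Fin q => prefixWord m (shiftMap^[j] x)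

theorem isPeriodicPt_of_minimalPeriod_eq {α : Type*} {f : α → α} {q : ℕ} {x : α}
    (hx : minimalPeriod f x = q) : IsPeriodicPt f q x :=
  hx ▸ isPeriodicPt_minimalPeriod f x

theorem prefixWord_iterate_mem_shiftPrefixes {A : Type*} [DecidableEq A] {m q : ℕ} {x : ℤ → A}
    (hq : 0 < q) (hx : minimalPeriod shiftMap x = q) (n : ℕ) :
    prefixWord m (shiftMap^[n] x) ∈ shiftPrefixes m q x := by
  refine mem_image.2 ⟨⟨n % q, Nat.mod_lt _ hq⟩, mem_univ _, ?_⟩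
  rw [(isPeriodicPt_of_minimalPeriod_eq hx).iterate_mod_apply]

theorem card_shiftPrefixes {A : Type*} [DecidableEq A] {m q : ℕ} {x : ℤ → A} (hq : 0 < q)
    (hm : q ≤ m) (hx : minimalPeriod shiftMap x = q) : #(shiftPrefixes m q x) = q := by
  have hper := isPeriodicPt_of_minimalPeriod_eq hx
  rw [shiftPrefixes, card_image_of_injective, card_univ, Fintype.card_fin]
  intro i j h
  have := prefixWord_injOn hq hm (hper.apply_iterate i) (hper.apply_iterate j) h
  exact Fin.ext <| (iterate_eq_iterate_iff_of_lt_minimalPeriod (hx.symm ▸ i.2)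
    (hx.symm ▸ j.2)).1 this

theorem disjoint_shiftPrefixes {A : Type*} [DecidableEq A] {m q : ℕ} {x y : ℤ → A} (hq : 0 < q)
    (hm : q ≤ m) (hx : minimalPeriod shiftMap x = q) (hy : minimalPeriod shiftMap y = q)
    (hxy : ∀ i j, shiftMap^[i] x ≠ shiftMap^[j] y) :
    Disjoint (shiftPrefixes m q x) (shiftPrefixes m q y) := by
  rw [disjoint_left]
  intro w hwx hwy
  obtain ⟨i, -, rfl⟩ := mem_image.1 hwx
  obtain ⟨j, -, h⟩ := mem_image.1 hwy
  exact hxy i j (prefixWord_injOn hq hm ((isPeriodicPt_of_minimalPeriod_eq hx).apply_iterate i)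
    ((isPeriodicPt_of_minimalPeriod_eq hy).apply_iterate j) h.symm)

open scoped Classical in
/-- The density of regular rules is `O(p / |A| ^ p)` for `p = 2 ^ k` with `2 p ≤ r + 1`. -/
theorem card_isRegularCA_le (A : Type) [Fintype A] [TopologicalSpace A]
    (hA : 2 ≤ Fintype.card A) {r k : ℕ} (hk : 2 ^ (k + 1) ≤ r + 1) :
    (#{φ : (Fin (r + 1) → A) → A | IsRegularCA (caOfRule φ)} : ℝ) *
        ((Real.exp (-2) * (1 - Real.exp (-(1 / 4)))) * (Fintype.card A : ℝ) ^ 2 ^ k) ≤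
      2 * 2 ^ k * Fintype.card ((Fin (r + 1) → A) → A) := by
  have hp : 0 < 2 ^ k := by positivity
  have hp2 : 0 < 2 ^ (k + 1) := by positivity
  have hpp2 : 2 ^ k ≤ 2 ^ (k + 1) := Nat.pow_le_pow_right two_pos k.le_succ
  obtain ⟨R, _, ρ, hρ, hρcov, hρinj, hρcard⟩ :=
    exists_orbit_transversal _ hp (finite_minimalPeriod_shiftMap A hp)
  obtain ⟨Q, _, τ, hτ, -, hτinj, hτcard⟩ :=
    exists_orbit_transversal _ hp2 (finite_minimalPeriod_shiftMap A hp2)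
  obtain ⟨hR1, hR2⟩ := ncard_minimalPeriod_shiftMap_bounds A hA k
  obtain ⟨-, hQ2⟩ := ncard_minimalPeriod_shiftMap_bounds A hA (k + 1)
  rw [← hρcard] at hR1 hR2
  rw [← hτcard] at hQ2
  have hρper := fun o => isPeriodicPt_of_minimalPeriod_eq (hρ o)
  have hτper := fun o => isPeriodicPt_of_minimalPeriod_eq (hτ o)
  have hρper2 : ∀ o, IsPeriodicPt shiftMap (2 ^ (k + 1)) (ρ o) := fun o =>
    (hρper o).trans_dvd (pow_dvd_pow 2 k.le_succ)
  let e : (R × Fin (2 ^ k)) ⊕ (Q × Fin (2 ^ (k + 1))) → (Fin (r + 1) → A) :=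
    Sum.elim (fun a => prefixWord (r + 1) (shiftMap^[a.2] (ρ a.1)))
      (fun a => prefixWord (r + 1) (shiftMap^[a.2] (τ a.1)))
  have hwin := prefixWord_injOn (A := A) hp2 hk
  have he : Injective e := by
    refine Injective.sumElim ?_ ?_ ?_
    · rintro ⟨o, i⟩ ⟨o', j⟩ h
      have h' := hwin ((hρper2 o).apply_iterate i) ((hρper2 o').apply_iterate j) h
      obtain rfl := hρinj _ _ _ _ h'
      rw [Fin.ext ((iterate_eq_iterate_iff_of_lt_minimalPeriod ((hρ o).symm ▸ i.2)
        ((hρ o).symm ▸ j.2)).1 h')]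
    · rintro ⟨o, i⟩ ⟨o', j⟩ h
      have h' := hwin ((hτper o).apply_iterate i) ((hτper o').apply_iterate j) h
      obtain rfl := hτinj _ _ _ _ h'
      rw [Fin.ext ((iterate_eq_iterate_iff_of_lt_minimalPeriod ((hτ o).symm ▸ i.2)
        ((hτ o).symm ▸ j.2)).1 h')]
    · rintro ⟨o, i⟩ ⟨o', j⟩ h
      have h' := hwin ((hρper2 o).apply_iterate i) ((hτper o').apply_iterate j) h
      have h'' := congrArg (minimalPeriod shiftMap) h'
      rw [minimalPeriod_apply_iterate ⟨_, hp2, hρper2 o⟩,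
        minimalPeriod_apply_iterate ⟨_, hp2, hτper o'⟩, hρ, hτ] at h''
      exact absurd (Nat.pow_right_injective le_rfl h'') (by omega)
  let G : ((R × Fin (2 ^ k)) ⊕ (Q × Fin (2 ^ (k + 1))) → A) ≃
      (R → Fin (2 ^ k) → A) × (Q → Fin (2 ^ (k + 1)) → A) :=
    (Equiv.sumArrowEquivProdArrow _ _ _).trans
      (Equiv.prodCongr (Equiv.curry _ _ _) (Equiv.curry _ _ _))
  let B : R → Finset (Fin (2 ^ k) → A) := fun y => shiftPrefixes _ (2 ^ k) (ρ y)
  let D : R → Finset (Fin (2 ^ (k + 1)) → A) := fun y => shiftPrefixes _ (2 ^ k) (ρ y)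
  have hG1 : ∀ (φ : (Fin (r + 1) → A) → A) o,
      (G (φ ∘ e)).1 o = prefixWord (2 ^ k) (caOfRule φ (ρ o)) := fun φ o => by
    funext i
    exact (caOfRule_apply_natCast φ (ρ o) i).symm
  have hG2 : ∀ (φ : (Fin (r + 1) → A) → A) o,
      (G (φ ∘ e)).2 o = prefixWord (2 ^ (k + 1)) (caOfRule φ (τ o)) := fun φ o => by
    funext i
    exact (caOfRule_apply_natCast φ (τ o) i).symm
  have hreg : ∀ φ : (Fin (r + 1) → A) → A, IsRegularCA (caOfRule φ) →
      ∀ y, G (φ ∘ e) ∉ avoidMeet (B y) (D y) := by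
    intro φ hφ y hy
    obtain ⟨havoid, q, hq⟩ := mem_avoidMeet.1 hy
    have hs := caOfRule_semiconj φ
    obtain ⟨j, -, hj⟩ := mem_image.1 hq
    rw [hG2] at hj
    have hτy := prefixWord_injOn hp2 le_rfl ((hρper2 y).apply_iterate j)
      ((hτper q).map hs) hj
    obtain ⟨z, hz, hfz⟩ := hφ.exists_minimalPeriod_preimage hs (τ q)
    rw [← hτy, minimalPeriod_apply_iterate ⟨_, hp, hρper y⟩, hρ] at hz
    obtain ⟨o, n, hon⟩ := hρcov z hz
    refine havoid o ?_
    have hback : shiftMap^[2 ^ k * n - n + j] (ρ y) = caOfRule φ (ρ o) := by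
      rw [iterate_add_apply, hτy, ← hfz, ← hon, (hs.iterate_right n).eq, ← iterate_add_apply,
        Nat.sub_add_cancel (Nat.le_mul_of_pos_left n hp)]
      exact ((hρper o).map hs).mul_const n
    rw [hG1, ← hback]
    exact prefixWord_iterate_mem_shiftPrefixes hp (hρ y) _
  have hcount := card_avoid_avoidMeet_le (R := R) (Q := Q) (b := 2 ^ k) B D
    (fun y => card_shiftPrefixes hp le_rfl (hρ y)) (fun y => card_shiftPrefixes hp hpp2 (hρ y))
    (fun y y' h => disjoint_shiftPrefixes hp le_rfl (hρ y) (hρ y') fun i j h' =>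
      h (hρinj _ _ _ _ h'))
    (fun y y' h => disjoint_shiftPrefixes hp hpp2 (hρ y) (hρ y') fun i j h' =>
      h (hρinj _ _ _ _ h'))
    (by
      rw [Fintype.card_fun, Fintype.card_fin]
      calc 2 * 2 ^ k ≤ 2 ^ 2 ^ k := by
            rw [← pow_succ']
            exact Nat.pow_le_pow_right two_pos (Nat.lt_pow_self one_lt_two)
        _ ≤ _ := Nat.pow_le_pow_left hA _)
    (by rwa [Fintype.card_fun, Fintype.card_fin])
    (by
      rw [Fintype.card_fun, Fintype.card_fin]
      refine hQ2.trans (le_of_eq ?_)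
      rw [pow_succ]; ring)
    (by rw [Fintype.card_fun]; positivity) (by rw [Fintype.card_fun]; positivity)
  have htransfer := card_filter_comp_injective e he
    fun ψ => ∀ y, G ψ ∉ avoidMeet (B y) (D y)
  rw [show #{ψ | ∀ y, G ψ ∉ avoidMeet (B y) (D y)} =
      #{w : (R → Fin (2 ^ k) → A) × (Q → Fin (2 ^ (k + 1)) → A) |
        ∀ y, w ∉ avoidMeet (B y) (D y)} from card_equiv G (by simp)] at htransfer
  rw [← Fintype.card_congr G] at hcount
  have hle : (#{φ : (Fin (r + 1) → A) → A | IsRegularCA (caOfRule φ)} : ℝ) ≤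
      #{φ : (Fin (r + 1) → A) → A | ∀ y, G (φ ∘ e) ∉ avoidMeet (B y) (D y)} := by
    exact_mod_cast card_le_card (monotone_filter_right _ fun φ _ => hreg φ)
  have hpos : (0 : ℝ) <
      Fintype.card ((R × Fin (2 ^ k)) ⊕ (Q × Fin (2 ^ (k + 1))) → A) := by
    have : Nonempty A := Fintype.card_pos_iff.1 (by omega)
    exact_mod_cast Fintype.card_pos
  have hR2' : (Fintype.card A : ℝ) ^ 2 ^ k ≤ 2 * (Fintype.card R * 2 ^ k) := by
    exact_mod_cast hR2
  rw [← @Nat.cast_inj ℝ, Nat.cast_mul, Nat.cast_mul] at htransfer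
  have hc : 0 ≤ Real.exp (-2) * (1 - Real.exp (-(1 / 4))) := by
    refine mul_nonneg (Real.exp_pos _).le ?_
    rw [sub_nonneg, Real.exp_le_one_iff]; norm_num
  refine le_of_mul_le_mul_right ?_ hpos
  generalize Real.exp (-2) * (1 - Real.exp (-(1 / 4))) = c at *
  calc _ ≤ (#{φ : (Fin (r + 1) → A) → A | ∀ y, G (φ ∘ e) ∉ avoidMeet (B y) (D y)} : ℝ) *
        (c * (2 * (Fintype.card R * 2 ^ k))) *
        Fintype.card ((R × Fin (2 ^ k)) ⊕ (Q × Fin (2 ^ (k + 1))) → A) := by gcongr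
    _ = (#{w : (R → Fin (2 ^ k) → A) × (Q → Fin (2 ^ (k + 1)) → A) |
        ∀ y, w ∉ avoidMeet (B y) (D y)} * (Fintype.card R * c)) *
        (2 * 2 ^ k * Fintype.card ((Fin (r + 1) → A) → A)) := by
      linear_combination (c * (2 * (Fintype.card R * 2 ^ k))) * htransfer
    _ ≤ Fintype.card ((R × Fin (2 ^ k)) ⊕ (Q × Fin (2 ^ (k + 1))) → A) *
        (2 * 2 ^ k * Fintype.card ((Fin (r + 1) → A) → A)) := by gcongr
    _ = _ := by ring

theorem two_pow_div_pow_le {n r m : ℕ} (hn : 2 ≤ n) (hr : 1 ≤ r) (hm : 0 < m)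
    (hmn : m ≤ n + r) :
    ∃ k, 2 ^ (k + 1) ≤ r + 1 ∧ (2 : ℝ) ^ k / (n : ℝ) ^ 2 ^ k ≤ 16 / m := by
  obtain ⟨k, hk⟩ : ∃ k, Nat.log 2 (r + 1) = k + 1 :=
    Nat.exists_eq_succ_of_ne_zero (Nat.log_pos one_lt_two (by omega)).ne'
  have h1 : 2 ^ (k + 1) ≤ r + 1 := hk ▸ Nat.pow_log_le_self 2 (by omega)
  have h2 : r + 1 < 2 ^ (k + 1 + 1) := hk ▸ Nat.lt_pow_succ_log_self one_lt_two (r + 1)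
  refine ⟨k, h1, ?_⟩
  have hp : 0 < 2 ^ k := by positivity
  rw [div_le_div_iff₀ (by positivity) (by positivity)]
  suffices h : 2 ^ k * m ≤ 16 * n ^ 2 ^ k by exact_mod_cast h
  have h3 : r + 1 < 4 * 2 ^ k := by rw [pow_succ, pow_succ] at h2; omega
  generalize 2 ^ k = p at *
  obtain ⟨s, rfl⟩ : ∃ s, p = s + 1 := ⟨p - 1, by omega⟩
  have h4 : s + 1 ≤ 2 ^ s := Nat.lt_two_pow_self
  have h5 : (s + 1) ^ 2 ≤ 2 * 2 ^ (s + 1) := by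
    clear * -
    induction s with
    | zero => norm_num
    | succ s ih =>
      have : s + 1 ≤ 2 ^ s := Nat.lt_two_pow_self
      rw [pow_succ 2 s] at ih
      rw [pow_succ 2 (s + 1), pow_succ 2 s]
      nlinarith
  have h6 : n * 2 ^ s ≤ n ^ (s + 1) := by
    rw [pow_succ']
    gcongr
  have h7 : 2 ^ (s + 1) ≤ n ^ (s + 1) := Nat.pow_le_pow_left hn _
  have h8 : (s + 1) * n ≤ n ^ (s + 1) := by nlinarith
  have h9 : (s + 1) * r ≤ (s + 1) * (4 * (s + 1)) := by gcongr; omega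
  nlinarith

end

open scoped Classical in
/-- A uniformly random one-sided CA is non-regular with high probability: for
every `ε > 0` there is `n₀` such that whenever `|A| = n ≥ 2`, `r ≥ 1` and
`n + r ≥ n₀`, the proportion of local rules `φ : A^{r+1} → A` whose CA `f_φ`
is von Neumann regular in `End(A^ℤ)` is at most `ε`. -/
theorem stmt19 (ε : ℝ) (hε : 0 < ε) :
    ∃ n₀ : ℕ, ∀ (A : Type) (_ : Fintype A) (_ : DecidableEq A)
      (_ : TopologicalSpace A) (_ : DiscreteTopology A) (r : ℕ),
      2 ≤ Fintype.card A → 1 ≤ r → n₀ ≤ Fintype.card A + r →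
      ((Finset.univ.filter
          (fun φ : (Fin (r + 1) → A) → A => IsRegularCA (caOfRule φ))).card : ℝ) /
        ((Finset.univ : Finset ((Fin (r + 1) → A) → A)).card : ℝ) ≤ ε := by
  set c : ℝ := Real.exp (-2) * (1 - Real.exp (-(1 / 4)))
  have hc0 : 0 < c := by
    refine mul_pos (Real.exp_pos _) ?_
    rw [sub_pos, Real.exp_lt_one_iff]; norm_num
  obtain ⟨m, hm⟩ := exists_nat_gt (32 / (c * ε))
  have hm0 : (0 : ℝ) < m := lt_of_le_of_lt (by positivity) hm
  refine ⟨m, fun A _ _ _ _ r hA hr hmn => ?_⟩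
  obtain ⟨k, hk, hbound⟩ := two_pow_div_pow_le hA hr (by exact_mod_cast hm0) hmn
  have hmain := card_isRegularCA_le A hA hk
  have : Nonempty A := Fintype.card_pos_iff.1 (by omega)
  have hn : (0 : ℝ) < Fintype.card A := by exact_mod_cast Fintype.card_pos
  have hW : (0 : ℝ) < Fintype.card ((Fin (r + 1) → A) → A) := by
    exact_mod_cast Fintype.card_pos
  rw [Finset.card_univ, div_le_iff₀ hW]
  have hkey : 2 * 2 ^ k ≤ ε * (c * (Fintype.card A : ℝ) ^ 2 ^ k) := by
    rw [div_lt_iff₀ (by positivity)] at hm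
    rw [div_le_div_iff₀ (by positivity) hm0] at hbound
    refine le_of_mul_le_mul_right ?_ hm0
    have := mul_le_mul_of_nonneg_right hm.le (by positivity : 0 ≤ (Fintype.card A : ℝ) ^ 2 ^ k)
    linarith
  refine le_of_mul_le_mul_right ?_
    (by positivity : 0 < c * (Fintype.card A : ℝ) ^ 2 ^ k)
  calc _ ≤ 2 * 2 ^ k * (Fintype.card ((Fin (r + 1) → A) → A) : ℝ) := by convert hmain
    _ ≤ ε * (c * (Fintype.card A : ℝ) ^ 2 ^ k) * Fintype.card ((Fin (r + 1) → A) → A) := by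
      gcongr
    _ = _ := by ring
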